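/- For any positive integer l and constants c, C > 0, there exists a constant C' > 0 such that for all t ≥ 0 and x ∈ ℝ³: (t/(4π)) ∫_{|y|=1} (1+t)^{-l/2} exp(-|x + c t y|²/(C(1+t))) dS_y ≤ C' (1+t)^{-l/2} exp(-(|x| - c t)²/(3C(1+t))). -/

import Mathlib

open MeasureTheory Real

open scoped ENNReal NNReal RealInnerProductSpace

section RadialProjection

variable {E : Type*} [NormedAddCommGroup E] [NormedSpace ℝ E]

theorem norm_inv_smul_sub_inv_smul_le {u v : E} (hu : 1 ≤ ‖u‖) (hv : 1 ≤ ‖v‖) :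
    ‖‖u‖⁻¹ • u - ‖v‖⁻¹ • v‖ ≤ 2 * ‖u - v‖ := by
  have hu0 : 0 < ‖u‖ := by linarith
  have hv0 : 0 < ‖v‖ := by linarith
  have hdecomp : ‖u‖⁻¹ • u - ‖v‖⁻¹ • v = ‖u‖⁻¹ • (u - v) + (‖u‖⁻¹ - ‖v‖⁻¹) • v := by
    rw [smul_sub, sub_smul]
    abel
  have hscalar : |‖u‖⁻¹ - ‖v‖⁻¹| * ‖v‖ = ‖u‖⁻¹ * |‖v‖ - ‖u‖| := by
    rw [inv_sub_inv hu0.ne' hv0.ne', abs_div, abs_of_pos (mul_pos hu0 hv0)]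
    field_simp
  have hinv : ‖u‖⁻¹ ≤ 1 := inv_le_one_of_one_le₀ hu
  have hsub : |‖v‖ - ‖u‖| ≤ ‖u - v‖ := norm_sub_rev u v ▸ abs_norm_sub_norm_le v u
  rw [hdecomp]
  calc ‖‖u‖⁻¹ • (u - v) + (‖u‖⁻¹ - ‖v‖⁻¹) • v‖
      ≤ ‖u‖⁻¹ * ‖u - v‖ + ‖u‖⁻¹ * |‖v‖ - ‖u‖| := by
        refine (norm_add_le _ _).trans_eq ?_
        rw [norm_smul, norm_smul, Real.norm_eq_abs, Real.norm_eq_abs, hscalar,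
          abs_of_pos (inv_pos.2 hu0)]
    _ ≤ 1 * ‖u - v‖ + 1 * ‖u - v‖ := by gcongr
    _ = 2 * ‖u - v‖ := by ring

end RadialProjection

theorem restrict_image_hausdorffMeasure_le_map {X Y : Type*}
    [EMetricSpace X] [MeasurableSpace X] [BorelSpace X]
    [EMetricSpace Y] [MeasurableSpace Y] [BorelSpace Y] {K : ℝ≥0} {f : X → Y}
    (hf : LipschitzWith K f) {d : ℝ} (hd : 0 ≤ d) (A : Set X) :
    (μH[d] : Measure Y).restrict (f '' A) ≤
      ((K : ℝ≥0∞) ^ d) • Measure.map f ((μH[d] : Measure X).restrict A) := by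
  refine Measure.le_iff.2 fun B hB => ?_
  have hfm : Measurable f := hf.continuous.measurable
  rw [Measure.restrict_apply hB, Measure.smul_apply, Measure.map_apply hfm hB,
    Measure.restrict_apply (hfm hB), smul_eq_mul, Set.inter_comm, ← Set.image_inter_preimage,
    Set.inter_comm]
  exact hf.hausdorffMeasure_image_le hd _

theorem lintegral_exp_neg_mul_sq_norm {V : Type*} [NormedAddCommGroup V] [InnerProductSpace ℝ V]
    [FiniteDimensional ℝ V] [MeasurableSpace V] [BorelSpace V] {b : ℝ} (hb : 0 < b) :
    ∫⁻ v : V, ENNReal.ofReal (rexp (-b * ‖v‖ ^ 2)) =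
      ENNReal.ofReal ((π / b) ^ (Module.finrank ℝ V / 2 : ℝ)) := by
  rw [← GaussianFourier.integral_rexp_neg_mul_sq_norm hb, ofReal_integral_eq_lintegral_ofReal]
  · refine Integrable.of_integral_ne_zero ?_
    rw [GaussianFourier.integral_rexp_neg_mul_sq_norm hb]
    positivity
  · exact Filter.Eventually.of_forall fun _ => (exp_pos _).le

instance isAddHaarMeasure_hausdorffMeasure_two :
    (μH[2] : Measure (EuclideanSpace ℝ (Fin 2))).IsAddHaarMeasure := by
  simpa using isAddHaarMeasure_hausdorffMeasure (E := EuclideanSpace ℝ (Fin 2))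

/-- The cap of angular radius `π / 3` about `p` on the unit sphere of `ℝ³`. -/
def sphericalCap (p : EuclideanSpace ℝ (Fin 3)) : Set (EuclideanSpace ℝ (Fin 3)) :=
  {y | ‖y‖ = 1 ∧ 1 / 2 ≤ ⟪p, y⟫}

theorem exists_linearIsometry_orthogonal {p : EuclideanSpace ℝ (Fin 3)} (hp : ‖p‖ = 1) :
    ∃ L : EuclideanSpace ℝ (Fin 2) →ₗᵢ[ℝ] EuclideanSpace ℝ (Fin 3),
      (∀ w, ⟪p, L w⟫ = 0) ∧ ∀ v, ⟪p, v⟫ = 0 → ∃ w, L w = v := by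
  have hp0 : p ≠ 0 := by
    rintro rfl
    simp at hp
  have : Fact (Module.finrank ℝ (EuclideanSpace ℝ (Fin 3)) = 2 + 1) := ⟨by simp⟩
  let e := (OrthonormalBasis.fromOrthogonalSpanSingleton (𝕜 := ℝ) 2 hp0).repr
  refine ⟨(ℝ ∙ p)ᗮ.subtypeₗᵢ.comp e.symm.toLinearIsometry, fun w => ?_, fun v hv => ?_⟩
  · exact Submodule.mem_orthogonal_singleton_iff_inner_right.1 (e.symm w).2
  · exact ⟨e ⟨v, Submodule.mem_orthogonal_singleton_iff_inner_right.2 hv⟩, by simp⟩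

theorem exists_gnomonic_chart {p : EuclideanSpace ℝ (Fin 3)} (hp : ‖p‖ = 1) :
    ∃ g : EuclideanSpace ℝ (Fin 2) → EuclideanSpace ℝ (Fin 3), LipschitzWith 2 g ∧
      (∀ w ∈ {w : EuclideanSpace ℝ (Fin 2) | ‖w‖ ^ 2 ≤ 3}, ‖w‖ ^ 2 / 6 ≤ 1 - ⟪p, g w⟫) ∧
      sphericalCap p ⊆ g '' {w : EuclideanSpace ℝ (Fin 2) | ‖w‖ ^ 2 ≤ 3} := by
  obtain ⟨L, hL, hLsurj⟩ := exists_linearIsometry_orthogonal hp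
  have hnorm : ∀ w, ‖p + L w‖ ^ 2 = 1 + ‖w‖ ^ 2 := fun w => by
    rw [norm_add_sq_real, hL, hp, L.norm_map]
    ring
  have hone : ∀ w, 1 ≤ ‖p + L w‖ := fun w => by
    nlinarith [hnorm w, norm_nonneg (p + L w), sq_nonneg ‖w‖]
  refine ⟨fun w => ‖p + L w‖⁻¹ • (p + L w), ?_, fun w hw => ?_, fun y hy => ?_⟩
  · refine LipschitzWith.of_dist_le_mul fun w w' => ?_
    rw [dist_eq_norm, dist_eq_norm]
    refine (norm_inv_smul_sub_inv_smul_le (hone w) (hone w')).trans_eq ?_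
    rw [add_sub_add_left_eq_sub, ← map_sub, L.norm_map]
    rfl
  · have hw : ‖w‖ ^ 2 ≤ 3 := hw
    have h1 := hone w
    have h2 := hnorm w
    have hq : ‖p + L w‖ ≤ 2 := by nlinarith
    have hinner : ⟪p, ‖p + L w‖⁻¹ • (p + L w)⟫ = ‖p + L w‖⁻¹ := by
      rw [inner_smul_right, inner_add_right, hL, real_inner_self_eq_norm_sq, hp]
      ring
    simp only [hinner]
    generalize ‖p + L w‖ = q at *
    have hq0 : 0 < q := by linarith
    rw [← sub_nonneg]
    have : 1 - q⁻¹ - ‖w‖ ^ 2 / 6 = (q - 1) * ((2 - q) * (q + 3)) / (6 * q) := by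
      rw [show ‖w‖ ^ 2 = q ^ 2 - 1 by linarith]
      field_simp
      ring
    rw [this]
    exact div_nonneg (mul_nonneg (by linarith) (mul_nonneg (by linarith) (by linarith)))
      (by linarith)
  · obtain ⟨hy1, hy2⟩ := hy
    have hs : 0 < ⟪p, y⟫ := by linarith
    obtain ⟨w, hw⟩ := hLsurj (⟪p, y⟫⁻¹ • y - p) (by
      rw [inner_sub_right, inner_smul_right, real_inner_self_eq_norm_sq, hp,
        inv_mul_cancel₀ hs.ne']
      norm_num)
    have hpw : p + L w = ⟪p, y⟫⁻¹ • y := by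
      rw [hw]
      abel
    have hpw' : ‖p + L w‖ = ⟪p, y⟫⁻¹ := by
      rw [hpw, norm_smul, hy1, mul_one, Real.norm_eq_abs, abs_of_pos (inv_pos.2 hs)]
    refine ⟨w, ?_, ?_⟩
    · have h := hnorm w
      have hinv : ⟪p, y⟫⁻¹ ≤ 2 := by
        rw [inv_le_comm₀ hs two_pos]
        linarith
      have : 0 < ⟪p, y⟫⁻¹ := inv_pos.2 hs
      rw [hpw'] at h
      change ‖w‖ ^ 2 ≤ 3
      nlinarith
    · change ‖p + L w‖⁻¹ • (p + L w) = y
      rw [hpw', hpw, inv_inv, smul_smul, mul_inv_cancel₀ hs.ne', one_smul]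

theorem exists_lintegral_sphericalCap_le :
    ∃ K : ℝ≥0, ∀ p : EuclideanSpace ℝ (Fin 3), ‖p‖ = 1 → ∀ b : ℝ, 0 < b →
      ∫⁻ y in sphericalCap p, ENNReal.ofReal (rexp (-b * (1 - ⟪p, y⟫))) ∂μH[2] ≤
        K * ENNReal.ofReal (1 / b) := by
  obtain ⟨a, ha⟩ : ∃ a : ℝ≥0, (μH[2] : Measure (EuclideanSpace ℝ (Fin 2))) = a • volume :=
    ⟨_, Measure.isAddLeftInvariant_eq_smul _ _⟩
  refine ⟨4 * (a * (6 * π).toNNReal), fun p hp b hb => ?_⟩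
  obtain ⟨g, hg, hgexp, hgcap⟩ := exists_gnomonic_chart hp
  set A := {w : EuclideanSpace ℝ (Fin 2) | ‖w‖ ^ 2 ≤ 3}
  have hA : MeasurableSet A := by
    refine measurableSet_le ?_ ?_ <;> fun_prop
  have hmeas : Measurable fun y => ENNReal.ofReal (rexp (-b * (1 - ⟪p, y⟫))) := by fun_prop
  calc ∫⁻ y in sphericalCap p, ENNReal.ofReal (rexp (-b * (1 - ⟪p, y⟫))) ∂μH[2]
      ≤ ∫⁻ y, ENNReal.ofReal (rexp (-b * (1 - ⟪p, y⟫)))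
          ∂((((2 : ℝ≥0) : ℝ≥0∞) ^ (2 : ℝ)) • Measure.map g (μH[2].restrict A)) :=
        lintegral_mono' ((Measure.restrict_mono_set _ hgcap).trans
          (restrict_image_hausdorffMeasure_le_map hg zero_le_two A)) le_rfl
    _ = 4 * ∫⁻ w in A, ENNReal.ofReal (rexp (-b * (1 - ⟪p, g w⟫))) ∂μH[2] := by
        rw [lintegral_smul_measure, lintegral_map hmeas hg.continuous.measurable, smul_eq_mul]
        norm_num
    _ ≤ 4 * ∫⁻ w in A, ENNReal.ofReal (rexp (-(b / 6) * ‖w‖ ^ 2)) ∂μH[2] := by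
        refine mul_le_mul_right (setLIntegral_mono' hA fun w hw => ?_) _
        refine ENNReal.ofReal_le_ofReal (exp_le_exp.2 ?_)
        nlinarith [hgexp w hw]
    _ ≤ 4 * ∫⁻ w, ENNReal.ofReal (rexp (-(b / 6) * ‖w‖ ^ 2))
          ∂(μH[2] : Measure (EuclideanSpace ℝ (Fin 2))) :=
        mul_le_mul_right (setLIntegral_le_lintegral _ _) _
    _ = 4 * (a * ENNReal.ofReal (π / (b / 6))) := by
        rw [ha, lintegral_smul_measure, lintegral_exp_neg_mul_sq_norm (by positivity)]
        simp [ENNReal.smul_def]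
    _ = _ := by
        rw [show π / (b / 6) = 6 * π * (1 / b) by field_simp,
          ENNReal.ofReal_mul (by positivity)]
        push_cast
        rw [ENNReal.ofReal]
        ring

theorem hausdorffMeasure_sphericalCap_lt_top {p : EuclideanSpace ℝ (Fin 3)} (hp : ‖p‖ = 1) :
    μH[2] (sphericalCap p) < ∞ := by
  obtain ⟨g, hg, -, hgcap⟩ := exists_gnomonic_chart hp
  refine (measure_mono hgcap).trans_lt ((hg.hausdorffMeasure_image_le zero_le_two _).trans_lt ?_)
  refine ENNReal.mul_lt_top (by norm_num) ?_
  refine (measure_mono (t := Metric.closedBall 0 2) fun w hw => ?_).trans_lt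
    measure_closedBall_lt_top
  have hw : ‖w‖ ^ 2 ≤ 3 := hw
  rw [mem_closedBall_zero_iff]
  nlinarith [norm_nonneg w]

theorem hausdorffMeasure_sphere_lt_top :
    μH[2] (Metric.sphere (0 : EuclideanSpace ℝ (Fin 3)) 1) < ∞ := by
  refine (isCompact_sphere _ _).measure_lt_top_of_nhdsWithin fun p hp => ?_
  have hp : ‖p‖ = 1 := by simpa using hp
  refine ⟨sphericalCap p, ?_, hausdorffMeasure_sphericalCap_lt_top hp⟩
  have hopen : {y : EuclideanSpace ℝ (Fin 3) | 1 / 2 < ⟪p, y⟫} ∈ nhds p := by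
    refine (isOpen_lt (by fun_prop) (by fun_prop)).mem_nhds ?_
    rw [Set.mem_ofPred_eq, real_inner_self_eq_norm_sq, hp]
    norm_num
  filter_upwards [mem_nhdsWithin_of_mem_nhds hopen, self_mem_nhdsWithin] with y hy hy'
  exact ⟨by simpa using hy', le_of_lt hy⟩

theorem integrableOn_sphere_of_continuous {f : EuclideanSpace ℝ (Fin 3) → ℝ} (hf : Continuous f) :
    IntegrableOn f (Metric.sphere 0 1) μH[2] :=
  hf.continuousOn.integrableOn_of_subset_isCompact (isCompact_sphere _ _)
    Metric.isClosed_sphere.measurableSet subset_rfl hausdorffMeasure_sphere_lt_top.ne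

theorem exists_integral_sphere_exp_le :
    ∃ K > 0, ∀ p : EuclideanSpace ℝ (Fin 3), ‖p‖ = 1 → ∀ b : ℝ, 0 < b →
      ∫ y in Metric.sphere (0 : EuclideanSpace ℝ (Fin 3)) 1, rexp (-b * (1 - ⟪p, y⟫)) ∂μH[2] ≤
        K / b := by
  obtain ⟨K, hK⟩ := exists_lintegral_sphericalCap_le
  set M := (μH[2] : Measure (EuclideanSpace ℝ (Fin 3))).real (Metric.sphere 0 1)
  have hM : 0 ≤ M := measureReal_nonneg
  refine ⟨K + 2 * M + 1, by positivity, fun p hp b hb => ?_⟩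
  set S := Metric.sphere (0 : EuclideanSpace ℝ (Fin 3)) 1
  have hint : IntegrableOn (fun y => rexp (-b * (1 - ⟪p, y⟫))) S μH[2] :=
    integrableOn_sphere_of_continuous (by fun_prop)
  have hcapS : sphericalCap p = S ∩ {y | 1 / 2 ≤ ⟪p, y⟫} := by
    ext y
    simp [sphericalCap, S]
  have hmeas : MeasurableSet {y : EuclideanSpace ℝ (Fin 3) | 1 / 2 ≤ ⟪p, y⟫} :=
    measurableSet_le (by fun_prop) (by fun_prop)
  rw [← integral_inter_add_sdiff hmeas hint, ← hcapS]
  have hnear : ∫ y in sphericalCap p, rexp (-b * (1 - ⟪p, y⟫)) ∂μH[2] ≤ K * (1 / b) := by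
    rw [integral_eq_lintegral_of_nonneg_ae (Filter.Eventually.of_forall fun _ => (exp_pos _).le)
      (by fun_prop)]
    refine ENNReal.toReal_le_of_le_ofReal (by positivity) ((hK p hp b hb).trans_eq ?_)
    rw [ENNReal.ofReal_mul K.coe_nonneg, ENNReal.ofReal_coe_nnreal]
  have hexp : rexp (-b / 2) ≤ 2 / b := by
    rw [neg_div, exp_neg, inv_le_comm₀ (exp_pos _) (by positivity), inv_div]
    linarith [add_one_le_exp (b / 2)]
  have hfar : ∫ y in S \ {y | 1 / 2 ≤ ⟪p, y⟫}, rexp (-b * (1 - ⟪p, y⟫)) ∂μH[2] ≤ 2 / b * M := by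
    have hle : ∀ y ∈ S \ {y | 1 / 2 ≤ ⟪p, y⟫}, ‖rexp (-b * (1 - ⟪p, y⟫))‖ ≤ 2 / b := by
      rintro y ⟨-, hy⟩
      have hy : ⟪p, y⟫ < 1 / 2 := not_le.1 hy
      rw [Real.norm_eq_abs, abs_of_pos (exp_pos _)]
      refine (exp_le_exp.2 ?_).trans hexp
      nlinarith
    refine (le_abs_self _).trans ((norm_setIntegral_le_of_norm_le_const
      ((measure_mono Set.sdiff_subset).trans_lt hausdorffMeasure_sphere_lt_top) hle).trans ?_)
    gcongr
    exact measureReal_mono Set.sdiff_subset hausdorffMeasure_sphere_lt_top.ne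
  calc _ ≤ K * (1 / b) + 2 / b * M := add_le_add hnear hfar
    _ = (K + 2 * M) / b := by ring
    _ ≤ (K + 2 * M + 1) / b := div_le_div_of_nonneg_right (by linarith) hb.le

theorem mul_exp_neg_le {c C t r : ℝ} (hc : 0 < c) (hC : 0 < C) (ht : 0 ≤ t)
    (h : t ≤ 1 ∨ r ≤ c * t / 2) :
    t * rexp (-(r - c * t) ^ 2 / (C * (1 + t))) ≤
      (1 + 12 * C / c ^ 2) * rexp (-(r - c * t) ^ 2 / (3 * C * (1 + t))) := by
  have h1t : 0 < 1 + t := by linarith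
  have hsplit : -(r - c * t) ^ 2 / (C * (1 + t)) =
      -(2 * (r - c * t) ^ 2 / (3 * C * (1 + t))) + -(r - c * t) ^ 2 / (3 * C * (1 + t)) := by
    field_simp
    ring
  rw [hsplit, exp_add, ← mul_assoc]
  refine mul_le_mul_of_nonneg_right ?_ (exp_pos _).le
  have hpos : 0 ≤ 12 * C / c ^ 2 := by positivity
  have hle1 : rexp (-(2 * (r - c * t) ^ 2 / (3 * C * (1 + t)))) ≤ 1 :=
    exp_le_one_iff.2 (neg_nonpos.2 (by positivity))
  rcases le_or_gt t 1 with ht1 | ht1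
  · nlinarith [exp_pos (-(2 * (r - c * t) ^ 2 / (3 * C * (1 + t))))]
  · have hr : r ≤ c * t / 2 := h.resolve_left ht1.not_ge
    have hsq : (c * t / 2) ^ 2 ≤ (r - c * t) ^ 2 := by
      rw [← neg_sq (r - c * t)]
      exact pow_le_pow_left₀ (by positivity) (by linarith) 2
    have hexp : c ^ 2 * t / (12 * C) ≤ 2 * (r - c * t) ^ 2 / (3 * C * (1 + t)) := by
      rw [div_le_div_iff₀ (by positivity) (by positivity)]
      have : c ^ 2 * t * (1 + t) ≤ 8 * (r - c * t) ^ 2 := by nlinarith [sq_nonneg c]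
      nlinarith
    have : t * rexp (-(2 * (r - c * t) ^ 2 / (3 * C * (1 + t)))) ≤ 12 * C / c ^ 2 := by
      rw [exp_neg, ← div_eq_mul_inv, div_le_iff₀ (exp_pos _)]
      have h2 : c ^ 2 * t / (12 * C) ≤ rexp (2 * (r - c * t) ^ 2 / (3 * C * (1 + t))) := by
        linarith [add_one_le_exp (2 * (r - c * t) ^ 2 / (3 * C * (1 + t)))]
      calc t = 12 * C / c ^ 2 * (c ^ 2 * t / (12 * C)) := by field_simp
        _ ≤ _ := by gcongr
    linarith

theorem norm_add_smul_sq_eq {x p y : EuclideanSpace ℝ (Fin 3)} (hx : x = -(‖x‖ • p))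
    (hy : ‖y‖ = 1) (s : ℝ) :
    ‖x + s • y‖ ^ 2 = (‖x‖ - s) ^ 2 + 2 * ‖x‖ * s * (1 - ⟪p, y⟫) := by
  have hinner : ⟪x, y⟫ = -(‖x‖ * ⟪p, y⟫) := by
    conv_lhs => rw [hx]
    rw [inner_neg_left, real_inner_smul_left]
  rw [norm_add_sq_real, inner_smul_right, norm_smul, hy, hinner, mul_one, Real.norm_eq_abs, sq_abs]
  ring

theorem exists_integral_sphere_gaussian_le {c C : ℝ} (hc : 0 < c) (hC : 0 < C) :
    ∃ K > 0, ∀ t : ℝ, 0 ≤ t → ∀ x : EuclideanSpace ℝ (Fin 3),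
      t * ∫ y in Metric.sphere (0 : EuclideanSpace ℝ (Fin 3)) 1,
          rexp (-‖x + (c * t) • y‖ ^ 2 / (C * (1 + t))) ∂μH[2] ≤
        K * rexp (-(‖x‖ - c * t) ^ 2 / (3 * C * (1 + t))) := by
  obtain ⟨K, hK0, hK⟩ := exists_integral_sphere_exp_le
  set S := Metric.sphere (0 : EuclideanSpace ℝ (Fin 3)) 1
  set M := (μH[2] : Measure (EuclideanSpace ℝ (Fin 3))).real S
  have hM : 0 ≤ M := measureReal_nonneg
  refine ⟨M * (1 + 12 * C / c ^ 2) + 2 * K * C / c ^ 2, by positivity, fun t ht x => ?_⟩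
  have h1t : 0 < 1 + t := by linarith
  obtain hcase | ⟨ht1, hr⟩ : (t ≤ 1 ∨ ‖x‖ ≤ c * t / 2) ∨ (1 < t ∧ c * t / 2 < ‖x‖) := by
    by_cases h1 : t ≤ 1 <;> by_cases h2 : ‖x‖ ≤ c * t / 2 <;> simp_all
  · have hle : ∀ y ∈ S, ‖rexp (-‖x + (c * t) • y‖ ^ 2 / (C * (1 + t)))‖ ≤
        rexp (-(‖x‖ - c * t) ^ 2 / (C * (1 + t))) := fun y hy => by
      have hy : ‖y‖ = 1 := by simpa [S] using hy
      rw [Real.norm_eq_abs, abs_of_pos (exp_pos _)]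
      have hsub : |‖x‖ - c * t| ≤ ‖x + (c * t) • y‖ := by
        have := abs_norm_sub_norm_le x (-((c * t) • y))
        rwa [norm_neg, norm_smul, hy, mul_one, Real.norm_eq_abs,
          abs_of_nonneg (show 0 ≤ c * t by positivity), sub_neg_eq_add] at this
      have hsq : (‖x‖ - c * t) ^ 2 ≤ ‖x + (c * t) • y‖ ^ 2 :=
        sq_abs (‖x‖ - c * t) ▸ pow_le_pow_left₀ (abs_nonneg _) hsub 2
      gcongr
    have hint := (le_abs_self _).trans
      (norm_setIntegral_le_of_norm_le_const hausdorffMeasure_sphere_lt_top hle)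
    calc _ ≤ t * (rexp (-(‖x‖ - c * t) ^ 2 / (C * (1 + t))) * M) := by gcongr
      _ = M * (t * rexp (-(‖x‖ - c * t) ^ 2 / (C * (1 + t)))) := by ring
      _ ≤ M * ((1 + 12 * C / c ^ 2) * rexp (-(‖x‖ - c * t) ^ 2 / (3 * C * (1 + t)))) :=
        mul_le_mul_of_nonneg_left (mul_exp_neg_le hc hC ht hcase) hM
      _ = M * (1 + 12 * C / c ^ 2) * rexp (-(‖x‖ - c * t) ^ 2 / (3 * C * (1 + t))) := by ring
      _ ≤ _ := by
        gcongr
        linarith [show 0 ≤ 2 * K * C / c ^ 2 by positivity]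
  · have ht0 : 0 < t := by linarith
    have hx0 : 0 < ‖x‖ := lt_trans (by positivity) hr
    set p := -(‖x‖⁻¹ • x)
    have hp : ‖p‖ = 1 := by
      rw [norm_neg, norm_smul, norm_inv, norm_norm, inv_mul_cancel₀ hx0.ne']
    have hxp : x = -(‖x‖ • p) := by
      rw [smul_neg, neg_neg, smul_smul, mul_inv_cancel₀ hx0.ne', one_smul]
    set b := 2 * ‖x‖ * (c * t) / (C * (1 + t))
    have hb : 0 < b := by positivity
    have hintegrand : ∀ y ∈ S, rexp (-‖x + (c * t) • y‖ ^ 2 / (C * (1 + t))) =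
        rexp (-(‖x‖ - c * t) ^ 2 / (C * (1 + t))) * rexp (-b * (1 - ⟪p, y⟫)) := fun y hy => by
      rw [norm_add_smul_sq_eq hxp (by simpa [S] using hy), ← exp_add]
      congr 1
      simp only [b]
      ring
    rw [setIntegral_congr_fun Metric.isClosed_sphere.measurableSet hintegrand,
      integral_const_mul]
    have hKb : t * (K / b) ≤ 2 * K * C / c ^ 2 := by
      have hbound : c ^ 2 * t / (2 * C) ≤ b := by
        rw [div_le_div_iff₀ (by positivity) (by positivity)]
        have h2 : c * t * (c * t) ≤ 2 * ‖x‖ * (c * t) :=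
          mul_le_mul_of_nonneg_right (by linarith) (by positivity)
        have h3 : c ^ 2 * t * (1 + t) ≤ 2 * (c * t * (c * t)) := by
          nlinarith [mul_pos (pow_pos hc 2) ht0]
        nlinarith
      calc t * (K / b) ≤ t * (K / (c ^ 2 * t / (2 * C))) := by gcongr
        _ = _ := by field_simp
    have hexp : rexp (-(‖x‖ - c * t) ^ 2 / (C * (1 + t))) ≤
        rexp (-(‖x‖ - c * t) ^ 2 / (3 * C * (1 + t))) := by
      rw [exp_le_exp, neg_div, neg_div, neg_le_neg_iff]
      gcongr
      linarith
    calc _ ≤ t * (rexp (-(‖x‖ - c * t) ^ 2 / (C * (1 + t))) * (K / b)) := by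
          gcongr
          exact hK p hp b hb
      _ = t * (K / b) * rexp (-(‖x‖ - c * t) ^ 2 / (C * (1 + t))) := by ring
      _ ≤ 2 * K * C / c ^ 2 * rexp (-(‖x‖ - c * t) ^ 2 / (3 * C * (1 + t))) := by gcongr
      _ ≤ _ := by
        gcongr
        linarith [show 0 ≤ M * (1 + 12 * C / c ^ 2) by positivity]

/-- Pointwise estimate of the Kirchhoff spherical mean of a Gaussian diffusion profile. -/
theorem kirchhoff_gaussian_estimate (l : ℕ) (hl : 1 ≤ l) (c C : ℝ) (hc : 0 < c) (hC : 0 < C) :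
    ∃ C' > 0, ∀ t : ℝ, 0 ≤ t → ∀ x : EuclideanSpace ℝ (Fin 3),
      (t / (4 * π)) *
        ∫ y in Metric.sphere (0 : EuclideanSpace ℝ (Fin 3)) 1,
          (1 + t) ^ (-(l : ℝ) / 2) * Real.exp (-‖x + (c * t) • y‖ ^ 2 / (C * (1 + t))) ∂(μH[2])
      ≤ C' * (1 + t) ^ (-(l : ℝ) / 2) * Real.exp (-(‖x‖ - c * t) ^ 2 / (3 * C * (1 + t))) := by
  obtain ⟨K, hK0, hK⟩ := exists_integral_sphere_gaussian_le hc hC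
  refine ⟨K / (4 * π), by positivity, fun t ht x => ?_⟩
  rw [integral_const_mul]
  calc _ = (1 + t) ^ (-(l : ℝ) / 2) / (4 * π) * (t * ∫ y in Metric.sphere 0 1,
          rexp (-‖x + (c * t) • y‖ ^ 2 / (C * (1 + t))) ∂μH[2]) := by ring
    _ ≤ (1 + t) ^ (-(l : ℝ) / 2) / (4 * π) *
          (K * rexp (-(‖x‖ - c * t) ^ 2 / (3 * C * (1 + t)))) := by
        exact mul_le_mul_of_nonneg_left (hK t ht x) (by positivity)
    _ = _ := by ring
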